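/- Let r ≥ 1 be odd and p ≥ 1 with p | r. Then f_{r,p,0}(u,v,w) = 1, f_{r,p,1}(u,v,w) = u, and for all n ≥ 2, f_{r,p,n}(u,v,w) = u·f_{r,p,n−1}(u,v,w) + (n−1)(v + (r−1)w^r)·f_{r,p,n−2}(u,v,w). -/

import Mathlib

open Finset MvPolynomial

/-- The colored permutation group `G_{r,n}`: pairs `(z, τ)` with `z : (ℤ/rℤ)ⁿ`
and `τ` a permutation of `[n]`. -/
abbrev ColoredPerm (r n : ℕ) : Type := (Fin n → ZMod r) × Equiv.Perm (Fin n)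

/-- Multiplication in `G_{r,n}`:
`(z, τ)(z', τ') = ((zᵢ + z'_{τ⁻¹(i)})ᵢ, τ ∘ τ')`. -/
def cpMul {r n : ℕ} (x y : ColoredPerm r n) : ColoredPerm r n :=
  (fun i => x.1 i + y.1 (x.2⁻¹ i), x.2 * y.2)

/-- The identity element of `G_{r,n}`. -/
def cpOne (r n : ℕ) : ColoredPerm r n := (fun _ => 0, 1)

/-- `π` is an involution: `π² = 1`. -/
def IsCPInvolution {r n : ℕ} (π : ColoredPerm r n) : Prop := cpMul π π = cpOne r n

instance {r n : ℕ} (π : ColoredPerm r n) : Decidable (IsCPInvolution π) :=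
  decidable_of_iff (cpMul π π = cpOne r n) Iff.rfl

/-- `csum π = Σᵢ zᵢ(π)`, each color regarded as an integer in `{0, …, r−1}`. -/
def csum {r n : ℕ} (π : ColoredPerm r n) : ℕ := ∑ i, (π.1 i).val

/-- `fix π`: the number of absolute fixed points, `#{i ∈ [n] : τ(i) = i}`. -/
noncomputable def fixc {r n : ℕ} (π : ColoredPerm r n) : ℕ := Nat.card {i : Fin n // π.2 i = i}

/-- `exc_A π = #{i ∈ {1, …, n−1} : z_{τ(i)}(π) = 0 and τ(i) > i}`
(`Fin n` encodes `[n]` via `i ↦ i + 1`, so `i ∈ {1, …, n−1}` reads `(i : ℕ) + 1 < n`). -/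
noncomputable def excA {r n : ℕ} (π : ColoredPerm r n) : ℕ :=
  Nat.card {i : Fin n // (i : ℕ) + 1 < n ∧ π.1 (π.2 i) = 0 ∧ i < π.2 i}

/-- The colored excedance number `exc^Clr π = r·exc_A π + csum π`. -/
noncomputable def excClr {r n : ℕ} (π : ColoredPerm r n) : ℕ := r * excA π + csum π

/-- `f_{r,p,n}(u,v,w) = Σ_{π ∈ I_{r,p,n}} u^{fix π} v^{exc_A π} w^{csum π}` in
`ℤ[u,v,w]`, where `I_{r,p,n}` is the set of involutions `π` of `G_{r,n}` with
`csum π ≡ 0 (mod p)`; the variables `u, v, w` are `X 0, X 1, X 2`. -/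
noncomputable def fpoly (r p n : ℕ) [NeZero r] : MvPolynomial (Fin 3) ℤ :=
  ∑ π : ColoredPerm r n,
    if IsCPInvolution π ∧ p ∣ csum π then
      X 0 ^ fixc π * X 1 ^ excA π * X 2 ^ csum π
    else 0

/-- Membership in the set of involutions, in terms of the underlying permutation and the colors. -/
lemma isCPInvolution_iff {r n : ℕ} (z : Fin n → ZMod r) (τ : Equiv.Perm (Fin n)) :
    IsCPInvolution (z, τ) ↔ τ * τ = 1 ∧ ∀ i, z i + z (τ i) = 0 := by
  unfold IsCPInvolution cpMul cpOne
  simp only [Prod.mk.injEq, funext_iff]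
  constructor
  · rintro ⟨h1, h2⟩
    have h3 : τ⁻¹ = τ := inv_eq_of_mul_eq_one_left h2
    rw [h3] at h1
    exact ⟨h2, h1⟩
  · rintro ⟨h2, h1⟩
    have h3 : τ⁻¹ = τ := inv_eq_of_mul_eq_one_left h2
    rw [h3]
    exact ⟨h1, h2⟩

lemma ZMod.eq_zero_of_add_self_of_odd {r : ℕ} (hodd : Odd r) {a : ZMod r} (h : a + a = 0) :
    a = 0 := by
  obtain ⟨k, hk⟩ := hodd
  have h1 : ((2 * k + 1 : ℕ) : ZMod r) = 0 := by rw [← hk]; exact ZMod.natCast_self r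
  push_cast at h1
  linear_combination a * h1 - (k : ZMod r) * h

lemma ZMod.val_add_val_of_add_eq_zero {r : ℕ} [NeZero r] {a b : ZMod r} (h : a + b = 0) :
    a.val + b.val = if a = 0 then 0 else r := by
  obtain rfl : b = -a := (neg_eq_of_add_eq_zero_right h).symm
  rw [ZMod.neg_val]
  have := a.val_lt
  split_ifs with h0
  · simp [h0]
  · omega

/-- Number of excedances of a permutation of `Fin n`. -/
def excCount {n : ℕ} (τ : Equiv.Perm (Fin n)) : ℕ := #{i | i < τ i}

/-- Number of fixed points of a permutation of `Fin n`. -/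
def fixCount {n : ℕ} (τ : Equiv.Perm (Fin n)) : ℕ := #{i | τ i = i}

lemma sum_eq_sum_excedances {n : ℕ} {τ : Equiv.Perm (Fin n)} (hτ : τ * τ = 1) (g : Fin n → ℕ) :
    ∑ i, g i = ∑ i with i < τ i, (g i + g (τ i)) + ∑ i with τ i = i, g i := by
  have hinv : ∀ i, τ (τ i) = i := fun i => by
    rw [← Equiv.Perm.mul_apply, hτ, Equiv.Perm.one_apply]
  have h1 : ∑ i with i < τ i, g (τ i) = ∑ i with τ i < i, g i :=
    Finset.sum_nbij' (fun i => τ i) (fun i => τ i) (by simp [hinv]) (by simp [hinv])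
      (by simp [hinv]) (by simp [hinv]) (by simp)
  rw [Finset.sum_add_distrib, h1]
  simp only [Finset.sum_filter, ← Finset.sum_add_distrib]
  refine Finset.sum_congr rfl fun i _ => ?_
  rcases lt_trichotomy i (τ i) with h | h | h
  · simp [h, h.not_gt, h.ne']
  · simp [← h]
  · simp [h, h.not_gt, h.ne]

lemma two_mul_excCount_add_fixCount {n : ℕ} {τ : Equiv.Perm (Fin n)} (hτ : τ * τ = 1) :
    2 * excCount τ + fixCount τ = n := by
  have := sum_eq_sum_excedances hτ fun _ => 1
  simp only [Finset.sum_const, smul_eq_mul, Finset.card_univ, Fintype.card_fin] at this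
  unfold excCount fixCount
  omega

lemma csum_eq_sum {r n : ℕ} [NeZero r] (hodd : Odd r) {z : Fin n → ZMod r}
    {τ : Equiv.Perm (Fin n)} (hτ : τ * τ = 1) (hz : ∀ i, z i + z (τ i) = 0) :
    csum (z, τ) = ∑ i with i < τ i, if z i = 0 then 0 else r := by
  unfold csum
  rw [sum_eq_sum_excedances hτ]
  have h0 : ∑ i with τ i = i, (z i).val = 0 := by
    refine Finset.sum_eq_zero fun i hi => ?_
    have h := hz i
    rw [(Finset.mem_filter.1 hi).2] at h
    rw [ZMod.eq_zero_of_add_self_of_odd hodd h, ZMod.val_zero]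
  simp only [h0, add_zero]
  exact Finset.sum_congr rfl fun i _ => ZMod.val_add_val_of_add_eq_zero (hz i)

lemma excA_eq_sum {r n : ℕ} {z : Fin n → ZMod r} {τ : Equiv.Perm (Fin n)}
    (hz : ∀ i, z i + z (τ i) = 0) :
    excA (z, τ) = ∑ i with i < τ i, if z i = 0 then 1 else 0 := by
  unfold excA
  rw [Nat.card_eq_fintype_card, Fintype.card_subtype, ← Finset.card_filter, Finset.filter_filter]
  congr 1
  ext i
  have h1 : z (τ i) = 0 ↔ z i = 0 := by
    have h := hz i
    constructor <;> intro h' <;> simpa [h'] using h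
  have h2 : i < τ i → (i : ℕ) + 1 < n := fun h => by
    have := (τ i).isLt
    rw [Fin.lt_def] at h
    omega
  simp only [Finset.mem_filter, Finset.mem_univ, true_and, h1]
  tauto

lemma fixc_eq_fixCount {r n : ℕ} (π : ColoredPerm r n) : fixc π = fixCount π.2 := by
  unfold fixc fixCount
  rw [Nat.card_eq_fintype_card, Fintype.card_subtype]

/-- Summing over the colorings compatible with a fixed involution. -/
lemma sum_colorings {r n : ℕ} [NeZero r] (hodd : Odd r) {R : Type*} [CommRing R] (v w : R)
    {τ : Equiv.Perm (Fin n)} (hτ : τ * τ = 1) :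
    ∑ z : Fin n → ZMod r with ∀ i, z i + z (τ i) = 0, v ^ excA (z, τ) * w ^ csum (z, τ) =
      (v + ((r - 1 : ℕ) : R) * w ^ r) ^ excCount τ := by
  have hinv : ∀ i, τ (τ i) = i := fun i => by
    rw [← Equiv.Perm.mul_apply, hτ, Equiv.Perm.one_apply]
  have hsum : ∑ c : ZMod r, (if c = 0 then v else w ^ r) = v + ((r - 1 : ℕ) : R) * w ^ r := by
    rw [← Finset.add_sum_erase _ _ (Finset.mem_univ (0 : ZMod r)), if_pos rfl,
      Finset.sum_congr rfl (g := fun _ => w ^ r)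
        (fun c hc => if_neg (Finset.ne_of_mem_erase hc)),
      Finset.sum_const, Finset.card_erase_of_mem (Finset.mem_univ _), Finset.card_univ,
      ZMod.card, nsmul_eq_mul]
  have hcard : excCount τ = Fintype.card {i : Fin n // i < τ i} := by
    rw [Fintype.card_subtype, excCount]
  rw [← hsum, hcard, ← Finset.card_univ, ← Finset.prod_const, Finset.prod_univ_sum,
    Fintype.piFinset_univ]
  refine Finset.sum_bij' (fun z _ i => z i)
    (fun f _ i => if h : i < τ i then f ⟨i, h⟩ else
      if h : τ i < i then -f ⟨τ i, by rwa [hinv]⟩ else 0) ?_ ?_ ?_ ?_ ?_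
  · simp
  · intro f _
    simp only [Finset.mem_filter, Finset.mem_univ, true_and]
    intro i
    rcases lt_trichotomy i (τ i) with h | h | h
    · simp [hinv, h, h.not_gt]
    · simp [← h]
    · simp [hinv, h, h.not_gt]
  · intro z hz
    simp only [Finset.mem_filter, Finset.mem_univ, true_and] at hz
    funext i
    rcases lt_trichotomy i (τ i) with h | h | h
    · simp [h]
    · have h' := hz i
      rw [← h] at h'
      simp [← h, ZMod.eq_zero_of_add_self_of_odd hodd h']
    · simp only [h, h.not_gt, dite_true, dite_false]
      exact neg_eq_of_add_eq_zero_left (hz i)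
  · intro f _
    funext i
    simp [i.2]
  · intro z hz
    simp only [Finset.mem_filter, Finset.mem_univ, true_and] at hz
    rw [excA_eq_sum hz, csum_eq_sum hodd hτ hz, ← Finset.prod_pow_eq_pow_sum,
      ← Finset.prod_pow_eq_pow_sum, ← Finset.prod_mul_distrib,
      Finset.prod_subtype (p := fun i => i < τ i) _ (by simp)]
    refine Finset.prod_congr rfl fun i _ => ?_
    split_ifs <;> simp

/-- Generating polynomial of the involutions of `Fin n`, with `X` marking fixed
points and `q` marking two-cycles. -/
noncomputable def involutionPoly {R : Type*} [CommRing R] (q : R) (n : ℕ) : Polynomial R :=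
  ∑ τ : Equiv.Perm (Fin n),
    if τ * τ = 1 then Polynomial.X ^ fixCount τ * Polynomial.C q ^ ((n - fixCount τ) / 2) else 0

lemma decomposeFin_symm_zero_mul_self {n : ℕ} (e : Equiv.Perm (Fin n)) :
    Equiv.Perm.decomposeFin.symm (0, e) * Equiv.Perm.decomposeFin.symm (0, e) = 1 ↔
      e * e = 1 := by
  simp [Equiv.ext_iff, Fin.forall_fin_succ]

lemma fixCount_decomposeFin_symm_zero {n : ℕ} (e : Equiv.Perm (Fin n)) :
    fixCount (Equiv.Perm.decomposeFin.symm (0, e)) = fixCount e + 1 := by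
  unfold fixCount
  rw [Fin.card_filter_univ_succ]
  simp

lemma decomposeFin_symm_succ_apply_succ {n : ℕ} (e : Equiv.Perm (Fin n)) (j x : Fin n) :
    Equiv.Perm.decomposeFin.symm (j.succ, e) x.succ = if e x = j then 0 else (e x).succ := by
  rw [Equiv.Perm.decomposeFin_symm_apply_succ, Equiv.swap_apply_def]
  simp [Fin.succ_ne_zero]

lemma decomposeFin_symm_succ_mul_self {n : ℕ} (e : Equiv.Perm (Fin n)) (j : Fin n) :
    Equiv.Perm.decomposeFin.symm (j.succ, e) * Equiv.Perm.decomposeFin.symm (j.succ, e) = 1 ↔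
      e * e = 1 ∧ e j = j := by
  simp only [Equiv.ext_iff, Fin.forall_fin_succ, Equiv.Perm.mul_apply, Equiv.Perm.one_apply,
    Equiv.Perm.decomposeFin_symm_apply_zero, decomposeFin_symm_succ_apply_succ]
  constructor
  · rintro ⟨h1, h2⟩
    have hj : e j = j := by
      by_contra h
      simp [h, Fin.succ_ne_zero] at h1
    refine ⟨fun x => ?_, hj⟩
    by_cases hx : e x = j
    · have : x = j := e.injective (hx.trans hj.symm)
      simp [this, hj]
    · have h := h2 x
      rw [if_neg hx, decomposeFin_symm_succ_apply_succ] at h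
      split_ifs at h
      · exact absurd h.symm (Fin.succ_ne_zero _)
      · exact Fin.succ_injective _ h
  · rintro ⟨h1, hj⟩
    refine ⟨by simp [hj], fun x => ?_⟩
    by_cases hx : e x = j
    · have : x = j := e.injective (hx.trans hj.symm)
      simp [this, hj]
    · have hxj : x ≠ j := fun h => hx (h ▸ hj)
      rw [if_neg hx, decomposeFin_symm_succ_apply_succ, h1, if_neg hxj]

lemma fixCount_decomposeFin_symm_succ {n : ℕ} {e : Equiv.Perm (Fin n)} {j : Fin n}
    (hj : e j = j) :
    fixCount (Equiv.Perm.decomposeFin.symm (j.succ, e)) + 1 = fixCount e := by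
  unfold fixCount
  rw [Fin.card_filter_univ_succ]
  simp only [Equiv.Perm.decomposeFin_symm_apply_zero, Fin.succ_ne_zero, if_false,
    decomposeFin_symm_succ_apply_succ]
  have hmem : j ∈ ({i | e i = i} : Finset (Fin n)) := by simp [hj]
  rw [← Finset.card_erase_add_one hmem]
  congr 2
  ext x
  simp only [Finset.mem_filter, Finset.mem_univ, true_and, Finset.mem_erase]
  by_cases hx : e x = j
  · have : x = j := e.injective (hx.trans hj.symm)
    simp [this, hj, (Fin.succ_ne_zero _).symm]
  · have hxj : x ≠ j := fun h => hx (h ▸ hj)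
    simp [hx, hxj]

lemma fixCount_le {n : ℕ} (e : Equiv.Perm (Fin n)) : fixCount e ≤ n :=
  (Finset.card_le_univ _).trans_eq (Fintype.card_fin n)

section

variable {R : Type*} [CommRing R] (q : R)

lemma involutionPoly_zero : involutionPoly q 0 = 1 := by
  simp [involutionPoly, fixCount]

lemma involutionPoly_succ (n : ℕ) :
    involutionPoly q (n + 1) = Polynomial.X * involutionPoly q n +
      Polynomial.C q * Polynomial.derivative (involutionPoly q n) := by
  conv_lhs => unfold involutionPoly
  rw [← Equiv.sum_comp Equiv.Perm.decomposeFin.symm, Fintype.sum_prod_type, Fin.sum_univ_succ]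
  congr 1
  · unfold involutionPoly
    rw [Finset.mul_sum]
    refine Finset.sum_congr rfl fun e _ => ?_
    simp only [decomposeFin_symm_zero_mul_self, fixCount_decomposeFin_symm_zero]
    split_ifs
    · rw [Nat.add_sub_add_right]
      ring
    · simp
  · unfold involutionPoly
    rw [Finset.sum_comm, Polynomial.derivative_sum, Finset.mul_sum]
    refine Finset.sum_congr rfl fun e _ => ?_
    simp only [decomposeFin_symm_succ_mul_self]
    by_cases he : e * e = 1
    · simp only [he, true_and, if_true]
      rw [← Finset.sum_filter]
      have hterm : ∀ j ∈ ({j | e j = j} : Finset (Fin n)),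
          Polynomial.X ^ fixCount (Equiv.Perm.decomposeFin.symm (j.succ, e)) *
            Polynomial.C q ^ ((n + 1 - fixCount (Equiv.Perm.decomposeFin.symm (j.succ, e))) / 2) =
          Polynomial.X ^ (fixCount e - 1) * Polynomial.C q ^ ((n - fixCount e) / 2 + 1) := by
        intro j hj
        have h := fixCount_decomposeFin_symm_succ (Finset.mem_filter.1 hj).2
        have h' := fixCount_le e
        congr 2 <;> omega
      rw [Finset.sum_congr rfl hterm, Finset.sum_const, Polynomial.derivative_mul,
        ← Polynomial.C_pow (n := (n - fixCount e) / 2), Polynomial.derivative_C,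
        Polynomial.derivative_X_pow, nsmul_eq_mul, ← fixCount]
      simp only [map_pow, map_natCast]
      ring
    · simp [he]

lemma derivative_involutionPoly_succ (n : ℕ) :
    Polynomial.derivative (involutionPoly q (n + 1)) =
      ((n + 1 : ℕ) : Polynomial R) * involutionPoly q n := by
  induction n with
  | zero => simp [involutionPoly_succ, involutionPoly_zero]
  | succ n ih =>
    rw [involutionPoly_succ, Polynomial.derivative_add, Polynomial.derivative_mul,
      Polynomial.derivative_mul, ih, Polynomial.derivative_mul, Polynomial.derivative_natCast,
      Polynomial.derivative_C, Polynomial.derivative_X, involutionPoly_succ q n]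
    push_cast
    ring

end

lemma fpoly_eq_eval {r p : ℕ} [NeZero r] (hodd : Odd r) (hpr : p ∣ r) (n : ℕ) :
    fpoly r p n =
      (involutionPoly (X 1 + ((r - 1 : ℕ) : MvPolynomial (Fin 3) ℤ) * X 2 ^ r) n).eval (X 0) := by
  unfold fpoly involutionPoly
  rw [Fintype.sum_prod_type_right, Polynomial.eval_finsetSum]
  refine Finset.sum_congr rfl fun τ _ => ?_
  by_cases hτ : τ * τ = 1
  · have hcount : (n - fixCount τ) / 2 = excCount τ := by
      have := two_mul_excCount_add_fixCount hτ
      omega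
    rw [if_pos hτ, hcount, Polynomial.eval_mul, Polynomial.eval_pow, Polynomial.eval_pow,
      Polynomial.eval_X, Polynomial.eval_C, ← sum_colorings hodd _ _ hτ, Finset.mul_sum,
      Finset.sum_filter]
    refine Finset.sum_congr rfl fun z _ => ?_
    by_cases hz : ∀ i, z i + z (τ i) = 0
    · have hdvd : p ∣ csum (z, τ) := by
        rw [csum_eq_sum hodd hτ hz]
        refine Finset.dvd_sum fun i _ => ?_
        split_ifs
        · exact dvd_zero p
        · exact hpr
      rw [if_pos ⟨(isCPInvolution_iff z τ).2 ⟨hτ, hz⟩, hdvd⟩, if_pos hz, fixc_eq_fixCount,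
        mul_assoc]
    · rw [if_neg fun h => hz ((isCPInvolution_iff z τ).1 h.1).2, if_neg hz]
  · rw [if_neg hτ, Polynomial.eval_zero]
    exact Finset.sum_eq_zero fun z _ => if_neg fun h => hτ ((isCPInvolution_iff z τ).1 h.1).1

/-- For odd `r ≥ 1` and `p ≥ 1` with `p ∣ r`:
`f_{r,p,0} = 1`, `f_{r,p,1} = u`, and for `n ≥ 2`,
`f_{r,p,n} = u·f_{r,p,n−1} + (n−1)(v + (r−1)wʳ)·f_{r,p,n−2}`. -/
theorem fpoly_recurrence_odd (r p : ℕ) [NeZero r] (hr : 1 ≤ r) (hodd : Odd r)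
    (hp : 1 ≤ p) (hpr : p ∣ r) :
    fpoly r p 0 = 1 ∧
    fpoly r p 1 = X 0 ∧
    ∀ n : ℕ, 2 ≤ n →
      fpoly r p n =
        X 0 * fpoly r p (n - 1) +
          ((n - 1 : ℕ) : MvPolynomial (Fin 3) ℤ) *
            (X 1 + ((r - 1 : ℕ) : MvPolynomial (Fin 3) ℤ) * X 2 ^ r) * fpoly r p (n - 2) := by
  refine ⟨?_, ?_, fun n hn => ?_⟩
  · simp [fpoly_eq_eval hodd hpr, involutionPoly_zero]
  · simp [fpoly_eq_eval hodd hpr, involutionPoly_succ, involutionPoly_zero]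
  · obtain ⟨m, rfl⟩ := Nat.exists_eq_add_of_le' hn
    simp only [fpoly_eq_eval hodd hpr, Nat.add_sub_cancel, show m + 2 - 1 = m + 1 from rfl]
    rw [involutionPoly_succ, derivative_involutionPoly_succ]
    simp only [Polynomial.eval_add, Polynomial.eval_mul, Polynomial.eval_X, Polynomial.eval_C,
      Polynomial.eval_natCast]
    ring
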